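/- arXiv:1606.07735 — 2 statements merged into one kernel-verified Lean document; each statement's English description precedes it below -/
import Mathlib

section
/- Let P : [0,T] → Matrix(n,n,ℝ) be continuously differentiable and satisfy the CRE Ṗ(t) = A(t)P(t) + P(t)A(t)ᵀ − P(t)C(t)ᵀQ(t)C(t)P(t) + V(t), with P(t) symmetric positive definite (hence invertible) for all t ∈ [0,T], V(t) symmetric positive semidefinite, the operator norm of A(t) bounded by k_a > 0, and tr(C(t)ᵀQ(t)C(t)) ≤ μ̄_q for all t. Then for all t ∈ [0,T], tr(P(t)⁻¹) ≤ (tr(P(0)⁻¹) + μ̄_q/(2 k_a))·exp(2 k_a t) − μ̄_q/(2 k_a). In particular no eigenvalue of P(t) can reach zero in finite time. -/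
open Matrix MeasureTheory

open scoped Matrix.Norms.L2Operator in
lemma cre_aux_deriv {n : ℕ} (P : ℝ → Matrix (Fin n) (Fin n) ℝ) (D : Matrix (Fin n) (Fin n) ℝ) (s : Set ℝ)
    (t : ℝ) (h : ∀ i j, HasDerivWithinAt (fun τ => P τ i j) (D i j) s t) (hP : (P t).PosDef) :
    HasDerivWithinAt (fun τ => ((P τ)⁻¹).trace) (-((P t)⁻¹ * D * (P t)⁻¹).trace) s t := by
  have h1 : HasDerivWithinAt P D s t := by
    have e : P = fun τ => ∑ i, ∑ j, P τ i j • Matrix.single i j (1:ℝ) := by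
      funext τ
      conv_lhs => rw [matrix_eq_sum_single (P τ)]
      simp
    have e2 : D = ∑ i, ∑ j, D i j • Matrix.single i j (1:ℝ) := by
      conv_lhs => rw [matrix_eq_sum_single D]
      simp
    rw [e, e2]
    refine HasDerivWithinAt.fun_sum fun i _ => HasDerivWithinAt.fun_sum fun j _ => ?_
    exact (h i j).smul_const _
  obtain ⟨u, hu⟩ := hP.isUnit
  have h2 := hasFDerivAt_ringInverse (𝕜 := ℝ) u
  rw [hu] at h2
  have h3 := h2.comp_hasDerivWithinAt t h1
  have h4 := (LinearMap.toContinuousLinearMap (Matrix.traceLinearMap (Fin n) ℝ ℝ)).hasFDerivAt.comp_hasDerivWithinAt t h3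
  have hui : (↑u⁻¹ : Matrix (Fin n) (Fin n) ℝ) = (P t)⁻¹ := by
    rw [← hu, Matrix.coe_units_inv]
  have hf : (fun τ => ((P τ)⁻¹).trace) =
      ⇑(LinearMap.toContinuousLinearMap (traceLinearMap (Fin n) ℝ ℝ)) ∘ Ring.inverse ∘ P := by
    funext τ
    simp [Matrix.nonsing_inv_eq_ringInverse]
  rw [hf]
  refine h4.congr_deriv ?_
  rw [hui]
  simp

lemma cre_aux_psd {n : ℕ} (A : Matrix (Fin n) (Fin n) ℝ) (k : ℝ)
    (hA : ‖Matrix.toEuclideanCLM (𝕜 := ℝ) A‖ ≤ k) :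
    ((2 * k) • (1 : Matrix (Fin n) (Fin n) ℝ) + (A + Aᵀ)).PosSemidef := by
  refine Matrix.PosSemidef.of_dotProduct_mulVec_nonneg ?_ fun x => ?_
  · simp [Matrix.IsHermitian, Matrix.conjTranspose_eq_transpose_of_trivial, add_comm]
  · have h1 : |x ⬝ᵥ A *ᵥ x| ≤ k * (x ⬝ᵥ x) := by
      have := abs_real_inner_le_norm (WithLp.toLp 2 x) (Matrix.toEuclideanCLM (𝕜 := ℝ) A (WithLp.toLp 2 x))
      have h2 := (Matrix.toEuclideanCLM (𝕜 := ℝ) A).le_opNorm (WithLp.toLp 2 x)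
      have h3 : ‖WithLp.toLp 2 x‖ * ‖WithLp.toLp 2 x‖ = x ⬝ᵥ x := by
        rw [← real_inner_self_eq_norm_mul_norm, EuclideanSpace.inner_eq_star_dotProduct]; simp
      have h4 : inner ℝ (WithLp.toLp 2 x) (Matrix.toEuclideanCLM (𝕜 := ℝ) A (WithLp.toLp 2 x)) = x ⬝ᵥ A *ᵥ x := by
        rw [EuclideanSpace.inner_eq_star_dotProduct]; simp [dotProduct_comm]
      rw [h4] at this
      rw [← h3]
      have h5 := norm_nonneg (WithLp.toLp 2 x)
      nlinarith [mul_le_mul_of_nonneg_right hA h5, mul_le_mul_of_nonneg_left h2 h5]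
    have h6 : x ⬝ᵥ Aᵀ *ᵥ x = x ⬝ᵥ A *ᵥ x := by
      rw [Matrix.mulVec_transpose, dotProduct_comm, ← Matrix.dotProduct_mulVec]
    simp only [star_trivial, Matrix.add_mulVec, dotProduct_add, h6, Matrix.smul_mulVec, Matrix.one_mulVec, dotProduct_smul, smul_eq_mul]
    linarith [(abs_le.1 h1).1]

open scoped MatrixOrder in
lemma cre_aux_trace {n : ℕ} (S M : Matrix (Fin n) (Fin n) ℝ) (hS : S.PosSemidef) (hM : M.PosSemidef) :
    0 ≤ (S * M).trace := by
  obtain ⟨B, hB⟩ := CStarAlgebra.nonneg_iff_eq_star_mul_self.1 hS.nonneg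
  have := (hM.mul_mul_conjTranspose_same B).trace_nonneg
  rwa [Matrix.trace_mul_comm, ← Matrix.mul_assoc, ← Matrix.star_eq_conjTranspose, ← hB] at this

/-- The trace of the inverse of a positive definite solution of the Continuous Riccati
Equation grows at most exponentially:
`tr(P(t)⁻¹) ≤ (tr(P(0)⁻¹) + μ̄_q/(2k_a)) exp(2 k_a t) − μ̄_q/(2 k_a)`,
hence no eigenvalue of `P(t)` can reach zero in finite time. -/
theorem cre_trace_inverse_upper_bound
    (n m : ℕ) (T : ℝ) (hT : 0 ≤ T)
    (A P V : ℝ → Matrix (Fin n) (Fin n) ℝ)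
    (C : ℝ → Matrix (Fin m) (Fin n) ℝ)
    (Q : ℝ → Matrix (Fin m) (Fin m) ℝ)
    (hCRE : ∀ t ∈ Set.Icc 0 T, ∀ i j, HasDerivWithinAt (fun τ => P τ i j)
      ((A t * P t + P t * (A t)ᵀ - P t * (C t)ᵀ * Q t * C t * P t + V t) i j)
      (Set.Icc 0 T) t)
    (hP : ∀ t ∈ Set.Icc 0 T, (P t).PosDef)
    (hV : ∀ t ∈ Set.Icc 0 T, (V t).PosSemidef)
    (k_a : ℝ) (hka : 0 < k_a)
    (hA : ∀ t ∈ Set.Icc 0 T, ‖Matrix.toEuclideanCLM (𝕜 := ℝ) (A t)‖ ≤ k_a)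
    (μq : ℝ) (hCQ : ∀ t ∈ Set.Icc 0 T, ((C t)ᵀ * Q t * C t).trace ≤ μq) :
    ∀ t ∈ Set.Icc 0 T,
      ((P t)⁻¹).trace ≤
        (((P 0)⁻¹).trace + μq / (2 * k_a)) * Real.exp (2 * k_a * t) - μq / (2 * k_a) := by
  have key : ∀ t ∈ Set.Icc 0 T, ∃ d, HasDerivWithinAt (fun τ => ((P τ)⁻¹).trace) d (Set.Icc 0 T) t ∧
      d ≤ 2 * k_a * ((P t)⁻¹).trace + μq := by
    intro t ht
    refine ⟨_, cre_aux_deriv P _ _ t (hCRE t ht) (hP t ht), ?_⟩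
    have hS := (hP t ht).inv.posSemidef
    have h1 := cre_aux_trace _ _ hS (cre_aux_psd (A t) k_a (hA t ht))
    have h2 := ((hV t ht).mul_mul_conjTranspose_same (P t)⁻¹).trace_nonneg
    rw [hS.1] at h2
    have hdet : IsUnit (P t).det := (Matrix.isUnit_iff_isUnit_det _).1 (hP t ht).isUnit
    have hq := hCQ t ht
    have e : (P t)⁻¹ * (A t * P t + P t * (A t)ᵀ - P t * (C t)ᵀ * Q t * C t * P t + V t) * (P t)⁻¹
        = (P t)⁻¹ * A t + (A t)ᵀ * (P t)⁻¹ - (C t)ᵀ * Q t * C t + (P t)⁻¹ * V t * (P t)⁻¹ := by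
      simp only [Matrix.mul_add, Matrix.add_mul, Matrix.mul_sub, Matrix.sub_mul, Matrix.mul_assoc,
        Matrix.mul_nonsing_inv _ hdet, Matrix.nonsing_inv_mul_cancel_left _ _ hdet, Matrix.mul_one]
    rw [e]
    simp only [Matrix.mul_add, Matrix.trace_add, Matrix.trace_sub, Matrix.mul_smul, Matrix.mul_one,
      Matrix.trace_smul, smul_eq_mul] at h1 ⊢
    rw [Matrix.trace_mul_comm (A t)ᵀ]
    linarith
  choose! d hd hd' using key
  let f : ℝ → ℝ := fun τ => (((P τ)⁻¹).trace + μq / (2 * k_a)) * Real.exp (-(2 * k_a * τ))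
  have hf : ∀ t ∈ Set.Icc 0 T, HasDerivWithinAt f
      ((d t - (2 * k_a * ((P t)⁻¹).trace + μq)) * Real.exp (-(2 * k_a * t))) (Set.Icc 0 T) t := by
    intro t ht
    have h1 : HasDerivAt (fun τ : ℝ => Real.exp (-(2 * k_a * τ)))
        (Real.exp (-(2 * k_a * t)) * (-(2 * k_a * 1))) t :=
      (((hasDerivAt_id t).const_mul (2 * k_a)).neg).exp
    refine (((hd t ht).add_const (μq / (2 * k_a))).mul h1.hasDerivWithinAt).congr_deriv ?_
    field_simp
    ring
  have hanti : AntitoneOn f (Set.Icc 0 T) := by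
    refine antitoneOn_of_hasDerivWithinAt_nonpos (convex_Icc 0 T)
      (fun t ht => (hf t ht).continuousWithinAt)
      (fun t ht => (hf t (interior_subset ht)).mono interior_subset) fun t ht => ?_
    exact mul_nonpos_of_nonpos_of_nonneg (by linarith [hd' t (interior_subset ht)]) (Real.exp_pos _).le
  intro t ht
  have h0 := hanti ⟨le_rfl, hT⟩ ht ht.1
  simp only [f, mul_zero, neg_zero, Real.exp_zero, mul_one, Real.exp_neg] at h0
  rw [← div_eq_mul_inv, div_le_iff₀ (Real.exp_pos _)] at h0
  linarith
end

section
/- Let l ≥ 1, z₁, …, z_l ∈ ℝⁿ, α ∈ ℝ^l with Σᵢ αᵢ = 1, ξ := (1, …, 1)ᵀ ∈ ℝ^l, D(α) := ξαᵀ − I_l, Z := [z₁ … z_l], and σ := Σᵢ αᵢ zᵢ. Let u : ℝ → ℝⁿ be bounded and twice continuously differentiable with bounded u̇ and ü, and suppose there exist δ > 0 and μ > 0 such that Z·D(α)ᵀD(α)·Zᵀ + (1/δ)∫_t^{t+δ} u̇(s)u̇(s)ᵀ ds ≥ μ·Iₙ for all t ≥ 0. Then there exists μ̄ > 0 such that for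 all t ≥ 0 and all (v₁, v₂, c₁, c₂, c₃) ∈ ℝⁿ × ℝⁿ × ℝ × ℝ × ℝ with |v₁|² + |v₂|² + c₁² + c₂² + c₃² = 1, one has (1/δ)∫_t^{t+δ} [ c₁² + |D(α)Zᵀ v₁|² + (u(s)ᵀv₁ − σᵀv₂ + c₂)² + |D(α)Zᵀ v₂|² + (u̇(s)ᵀv₁ + 2·u(s)ᵀv₂ + c₃)² ] ds ≥ μ̄. -/
open Matrix MeasureTheory

/-- Entrywise integral of a matrix-valued function. -/
noncomputable def matInt {ι κ : Type*} (f : ℝ → Matrix ι κ ℝ) (a b : ℝ) : Matrix ι κ ℝ :=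
  Matrix.of fun i j => ∫ s in a..b, f s i j

lemma aux_pt (K δ ε : ℝ) (hK : 0 < K) (hδ : 0 < δ) (hε : 0 < ε) :
    ∃ η > (0 : ℝ), ∀ (t : ℝ) (f f' : ℝ → ℝ), (∀ s, HasDerivAt f (f' s) s) →
      (∀ s, |f s| ≤ K) → (∀ s, |f' s| ≤ K) →
      (∫ s in t..(t + δ), f s ^ 2) ≤ η → ∀ s ∈ Set.Icc t (t + δ), f s ^ 2 ≤ ε := by
  obtain ⟨h, h0, h1, h2⟩ : ∃ h > 0, h ≤ δ ∧ 2 * K * K * h ≤ ε / 2 := by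
    refine ⟨min δ (ε / (4 * K * K)), by positivity, min_le_left _ _, ?_⟩
    calc 2 * K * K * min δ (ε / (4 * K * K)) ≤ 2 * K * K * (ε / (4 * K * K)) := by
          gcongr; exact min_le_right _ _
      _ = ε / 2 := by field_simp; ring
  refine ⟨h * (ε / 2), by positivity, ?_⟩
  intro t f f' hf hb hb' hint s hs
  have hfc : Continuous f := continuous_iff_continuousAt.2 fun s => (hf s).continuousAt
  have hlip : ∀ x y, |f x ^ 2 - f y ^ 2| ≤ 2 * K * K * |x - y| := by
    intro x y
    have := Convex.norm_image_sub_le_of_norm_hasDerivWithin_le (f := f) (f' := f') (C := K)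
      (s := Set.univ) (x := y) (y := x) (fun z _ => (hf z).hasDerivWithinAt)
      (fun z _ => hb' z) convex_univ (Set.mem_univ _) (Set.mem_univ _)
    simp only [Real.norm_eq_abs] at this
    have e : f x ^ 2 - f y ^ 2 = (f x + f y) * (f x - f y) := by ring
    rw [e, abs_mul]
    have h3 : |f x + f y| ≤ 2 * K := by
      have := abs_add_le (f x) (f y)
      linarith [hb x, hb y]
    calc _ ≤ 2 * K * (K * |x - y|) := by gcongr
      _ = _ := by ring
  obtain ⟨a, ha, ha', ha1, ha2⟩ : ∃ a, t ≤ a ∧ a + h ≤ t + δ ∧ a ≤ s ∧ s ≤ a + h := by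
    obtain ⟨hs1, hs2⟩ := hs
    rcases le_total s (t + δ - h) with hc | hc
    · exact ⟨s, hs1, by linarith, le_rfl, by linarith⟩
    · exact ⟨t + δ - h, by linarith, by linarith, by linarith, by linarith⟩
  have hsub : (∫ x in a..(a + h), f x ^ 2) ≤ ∫ x in t..(t + δ), f x ^ 2 := by
    apply intervalIntegral.integral_mono_interval ha (by linarith) ha'
    · exact Filter.Eventually.of_forall fun x => sq_nonneg _
    · exact (hfc.fun_pow 2).intervalIntegrable _ _
  have hlow : (∫ x in a..(a + h), (f s ^ 2 - ε / 2)) ≤ ∫ x in a..(a + h), f x ^ 2 := by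
    apply intervalIntegral.integral_mono_on (by linarith) (by simp)
      ((hfc.fun_pow 2).intervalIntegrable _ _)
    intro x hx
    have h3 := (abs_le.1 (hlip s x)).2
    have h4 : |s - x| ≤ h := abs_le.2 ⟨by linarith [hx.2], by linarith [hx.1]⟩
    have h5 : 2 * K * K * |s - x| ≤ 2 * K * K * h := by gcongr
    linarith
  rw [intervalIntegral.integral_const, smul_eq_mul] at hlow
  have : h * (f s ^ 2 - ε / 2) ≤ h * (ε / 2) := by
    have e : a + h - a = h := by ring
    rw [e] at hlow; linarith
  have := le_of_mul_le_mul_left this h0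
  linarith

lemma aux_A (K δ ε : ℝ) (hK : 0 < K) (hδ : 0 < δ) (hε : 0 < ε) :
    ∃ η > (0 : ℝ), ∀ (t : ℝ) (f f' f'' : ℝ → ℝ), (∀ s, HasDerivAt f (f' s) s) →
      (∀ s, HasDerivAt f' (f'' s) s) → Continuous f'' →
      (∀ s, |f s| ≤ K) → (∀ s, |f' s| ≤ K) → (∀ s, |f'' s| ≤ K) →
      (∫ s in t..(t + δ), f s ^ 2) ≤ η → (∫ s in t..(t + δ), f' s ^ 2) ≤ ε := by
  set e : ℝ := ε / (2 * K + K * δ) with he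
  have hepos : 0 < e := by positivity
  obtain ⟨η, hη, H⟩ := aux_pt K δ (e ^ 2) hK hδ (by positivity)
  refine ⟨η, hη, ?_⟩
  intro t f f' f'' hf hf' hc hb hb' hb'' hint
  have hp : ∀ s ∈ Set.Icc t (t + δ), |f s| ≤ e := fun s hs =>
    abs_le_of_sq_le_sq (H t f f' hf hb hb' hint s hs) hepos.le
  have hfc : Continuous f := continuous_iff_continuousAt.2 fun s => (hf s).continuousAt
  have hfc' : Continuous f' := continuous_iff_continuousAt.2 fun s => (hf' s).continuousAt
  have ibp := intervalIntegral.integral_mul_deriv_eq_deriv_mul (a := t) (b := t + δ)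
    (u := f') (v := f) (u' := f'') (v' := f') (fun x _ => hf' x) (fun x _ => hf x)
    (hc.intervalIntegrable _ _) (hfc'.intervalIntegrable _ _)
  have e1 : (∫ s in t..(t + δ), f' s ^ 2) = ∫ s in t..(t + δ), f' s * f' s := by
    simp only [sq]
  rw [e1, ibp]
  have hB : ∀ s ∈ Set.Icc t (t + δ), ∀ g : ℝ, |g| ≤ K → |g * f s| ≤ K * e := by
    intro s hs g hg
    rw [abs_mul]
    have := hp s hs
    gcongr
  have b1 := abs_le.1 (hB (t + δ) ⟨by linarith, le_rfl⟩ _ (hb' (t + δ)))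
  have b2 := abs_le.1 (hB t ⟨le_rfl, by linarith⟩ _ (hb' t))
  have b3 : ‖∫ s in t..(t + δ), f'' s * f s‖ ≤ K * e * |t + δ - t| := by
    apply intervalIntegral.norm_integral_le_of_norm_le_const
    intro x hx
    rw [Set.uIoc_of_le (by linarith)] at hx
    exact hB x ⟨hx.1.le, hx.2⟩ _ (hb'' x)
  rw [add_sub_cancel_left, abs_of_pos hδ, Real.norm_eq_abs] at b3
  have b3 := abs_le.1 b3
  have : K * e + K * e + K * e * δ = ε := by
    rw [he]; field_simp; ring
  linarith [b1.2, b2.1, b3.1]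

lemma aux_cs {n : ℕ} (x v : Fin n → ℝ) (c : ℝ) (hx : ‖x‖ ≤ c) :
    (x ⬝ᵥ v) ^ 2 ≤ n * c ^ 2 * (v ⬝ᵥ v) := by
  have h1 : (x ⬝ᵥ v) ^ 2 ≤ (∑ i, x i ^ 2) * (∑ i, v i ^ 2) :=
    Finset.sum_mul_sq_le_sq_mul_sq _ _ _
  have h2 : (∑ i, x i ^ 2) ≤ n * c ^ 2 := by
    calc (∑ i, x i ^ 2) ≤ ∑ i : Fin n, c ^ 2 := by
          apply Finset.sum_le_sum
          intro i _
          have := (norm_le_pi_norm x i).trans hx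
          rw [← sq_abs]
          exact pow_le_pow_left₀ (abs_nonneg _) this 2
      _ = _ := by simp
  have h3 : v ⬝ᵥ v = ∑ i, v i ^ 2 := by simp [dotProduct, sq]
  rw [h3]
  have : 0 ≤ ∑ i, v i ^ 2 := Finset.sum_nonneg fun i _ => sq_nonneg _
  nlinarith

lemma aux_pe {n l : ℕ} (Z : Matrix (Fin n) (Fin l) ℝ) (D : Matrix (Fin l) (Fin l) ℝ)
    (w : ℝ → Fin n → ℝ) (hw : Continuous w) (δ μ t : ℝ)
    (h : (Z * Dᵀ * D * Zᵀ + (1 / δ) • matInt (fun s => vecMulVec (w s) (w s)) t (t + δ)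
        - μ • (1 : Matrix (Fin n) (Fin n) ℝ)).PosSemidef) (v : Fin n → ℝ) :
    μ * (v ⬝ᵥ v) ≤ ((D * Zᵀ) *ᵥ v) ⬝ᵥ ((D * Zᵀ) *ᵥ v) +
      (1 / δ) * ∫ s in t..(t + δ), (w s ⬝ᵥ v) ^ 2 := by
  have h1 := h.dotProduct_mulVec_nonneg v
  simp only [star_trivial, Matrix.sub_mulVec, Matrix.add_mulVec, Matrix.smul_mulVec,
    dotProduct_sub, dotProduct_add, dotProduct_smul, Matrix.one_mulVec, smul_eq_mul] at h1
  have e1 : v ⬝ᵥ ((Z * Dᵀ * D * Zᵀ) *ᵥ v) = ((D * Zᵀ) *ᵥ v) ⬝ᵥ ((D * Zᵀ) *ᵥ v) := by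
    have : Z * Dᵀ * D * Zᵀ = (D * Zᵀ)ᵀ * (D * Zᵀ) := by
      simp [Matrix.transpose_mul, Matrix.mul_assoc]
    rw [this, ← Matrix.mulVec_mulVec, Matrix.dotProduct_mulVec, Matrix.vecMul_transpose]
  have e2 : v ⬝ᵥ (matInt (fun s => vecMulVec (w s) (w s)) t (t + δ) *ᵥ v)
      = ∫ s in t..(t + δ), (w s ⬝ᵥ v) ^ 2 := by
    have hwi : ∀ i, Continuous fun s => w s i := fun i => (continuous_apply i).comp hw
    have : ∀ s, (w s ⬝ᵥ v) ^ 2 = ∑ i, ∑ j, v i * (w s i * w s j * v j) := by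
      intro s
      simp only [dotProduct, sq, Finset.sum_mul_sum]
      refine Finset.sum_congr rfl fun i _ => Finset.sum_congr rfl fun j _ => by ring
    simp only [this]
    rw [intervalIntegral.integral_finsetSum]
    · simp only [dotProduct, mulVec, matInt, Matrix.of_apply, vecMulVec_apply, Finset.mul_sum]
      refine Finset.sum_congr rfl fun i _ => ?_
      rw [intervalIntegral.integral_finsetSum]
      · refine Finset.sum_congr rfl fun j _ => ?_
        rw [intervalIntegral.integral_const_mul, intervalIntegral.integral_mul_const]
      · intro j _
        exact Continuous.intervalIntegrable (by have := hwi i; have := hwi j; fun_prop) _ _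
    · intro i _
      exact Continuous.intervalIntegrable (continuous_finsetSum _ fun j _ => by
        have := hwi i; have := hwi j; fun_prop) _ _
  rw [e1, e2] at h1
  linarith

lemma aux_sq1 (a b c : ℝ) : (2 * b + c) ^ 2 ≤ 2 * (a + 2 * b + c) ^ 2 + 2 * a ^ 2 := by
  nlinarith [sq_nonneg (2 * a + 2 * b + c)]

lemma aux_sq2 (x y c : ℝ) (hx : x ^ 2 ≤ 1 / 100) (hy : y ^ 2 ≤ 1 / 100) :
    c ^ 2 / 3 - 2 / 100 ≤ (x - y + c) ^ 2 := by
  nlinarith [sq_nonneg ((x - y + c) + x), sq_nonneg ((x - y + c) - y), sq_nonneg (x + y)]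

lemma aux_sq3 (x c : ℝ) (hx : x ^ 2 ≤ 1 / 100) :
    c ^ 2 / 2 - 4 / 100 ≤ (2 * x + c) ^ 2 := by
  nlinarith [sq_nonneg (4 * x + c)]

set_option maxHeartbeats 1000000 in
/-- Lemma 9 of the paper (observability for multiple range measurements with biased
velocity): if `Z D(α)ᵀ D(α) Zᵀ + (1/δ)∫ u̇ u̇ᵀ ≥ μ I` then the corresponding Grammian
quadratic form is uniformly bounded below by some `μ̄ > 0`. -/
theorem pe_multiple_range_biased_grammian
    (n l : ℕ) (hl : 1 ≤ l)
    (z : Fin l → Fin n → ℝ)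
    (α : Fin l → ℝ) (hα : ∑ i, α i = 1)
    (ξ : Fin l → ℝ) (hξ : ξ = fun _ => 1)
    (D : Matrix (Fin l) (Fin l) ℝ) (hD : D = vecMulVec ξ α - 1)
    (Z : Matrix (Fin n) (Fin l) ℝ) (hZ : Z = Matrix.of fun i j => z j i)
    (σ : Fin n → ℝ) (hσ : σ = fun i => ∑ j, α j * z j i)
    (u u' u'' : ℝ → Fin n → ℝ)
    (hu' : ∀ t i, HasDerivAt (fun τ => u τ i) (u' t i) t)
    (hu'' : ∀ t i, HasDerivAt (fun τ => u' τ i) (u'' t i) t)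
    (hu''cont : Continuous u'')
    (cu cu' cu'' : ℝ)
    (hub : ∀ t, ‖u t‖ ≤ cu) (hu'b : ∀ t, ‖u' t‖ ≤ cu') (hu''b : ∀ t, ‖u'' t‖ ≤ cu'')
    (δ μ : ℝ) (hδ : 0 < δ) (hμ : 0 < μ)
    (hpe : ∀ t, 0 ≤ t →
      (Z * Dᵀ * D * Zᵀ + (1 / δ) • matInt (fun s => vecMulVec (u' s) (u' s)) t (t + δ)
        - μ • (1 : Matrix (Fin n) (Fin n) ℝ)).PosSemidef) :
    ∃ μ' > (0 : ℝ), ∀ t, 0 ≤ t →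
      ∀ (v₁ v₂ : Fin n → ℝ) (c₁ c₂ c₃ : ℝ),
        v₁ ⬝ᵥ v₁ + v₂ ⬝ᵥ v₂ + c₁ ^ 2 + c₂ ^ 2 + c₃ ^ 2 = 1 →
        (1 / δ) * ∫ s in t..(t + δ),
          (c₁ ^ 2 + ((D * Zᵀ) *ᵥ v₁) ⬝ᵥ ((D * Zᵀ) *ᵥ v₁) +
            (u s ⬝ᵥ v₁ - σ ⬝ᵥ v₂ + c₂) ^ 2 +
            ((D * Zᵀ) *ᵥ v₂) ⬝ᵥ ((D * Zᵀ) *ᵥ v₂) +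
            (u' s ⬝ᵥ v₁ + 2 * (u s ⬝ᵥ v₂) + c₃) ^ 2) ≥ μ' := by
  have hucts : Continuous u := continuous_pi fun i =>
    continuous_iff_continuousAt.2 fun s => (hu' s i).continuousAt
  have hucts' : Continuous u' := continuous_pi fun i =>
    continuous_iff_continuousAt.2 fun s => (hu'' s i).continuousAt
  have hder : ∀ (v : Fin n → ℝ) s, HasDerivAt (fun τ => u τ ⬝ᵥ v) (u' s ⬝ᵥ v) s := by
    intro v s
    simp only [dotProduct]
    exact HasDerivAt.fun_sum fun i _ => (hu' s i).mul_const _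
  have hder' : ∀ (v : Fin n → ℝ) s, HasDerivAt (fun τ => u' τ ⬝ᵥ v) (u'' s ⬝ᵥ v) s := by
    intro v s
    simp only [dotProduct]
    exact HasDerivAt.fun_sum fun i _ => (hu'' s i).mul_const _
  have hc0 : ∀ v : Fin n → ℝ, Continuous fun s => u s ⬝ᵥ v := fun v =>
    hucts.dotProduct continuous_const
  have hc1 : ∀ v : Fin n → ℝ, Continuous fun s => u' s ⬝ᵥ v := fun v =>
    hucts'.dotProduct continuous_const
  have hc2 : ∀ v : Fin n → ℝ, Continuous fun s => u'' s ⬝ᵥ v := fun v =>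
    hu''cont.dotProduct continuous_const
  have hnn : ∀ {m : ℕ} (v : Fin m → ℝ), 0 ≤ v ⬝ᵥ v := fun v =>
    Finset.sum_nonneg fun i _ => mul_self_nonneg _
  obtain ⟨B, hB1, hBu, hBu', hBu'', hBσ⟩ : ∃ B : ℝ, 1 ≤ B ∧
      (∀ s (v : Fin n → ℝ), (u s ⬝ᵥ v) ^ 2 ≤ B * (v ⬝ᵥ v)) ∧
      (∀ s (v : Fin n → ℝ), (u' s ⬝ᵥ v) ^ 2 ≤ B * (v ⬝ᵥ v)) ∧
      (∀ s (v : Fin n → ℝ), (u'' s ⬝ᵥ v) ^ 2 ≤ B * (v ⬝ᵥ v)) ∧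
      (∀ v : Fin n → ℝ, (σ ⬝ᵥ v) ^ 2 ≤ B * (v ⬝ᵥ v)) := by
    have p1 : 0 ≤ n * cu ^ 2 := by positivity
    have p2 : 0 ≤ n * cu' ^ 2 := by positivity
    have p3 : 0 ≤ n * cu'' ^ 2 := by positivity
    have p4 : 0 ≤ n * ‖σ‖ ^ 2 := by positivity
    refine ⟨n * cu ^ 2 + n * cu' ^ 2 + n * cu'' ^ 2 + n * ‖σ‖ ^ 2 + 1, by linarith,
      fun s v => ?_, fun s v => ?_, fun s v => ?_, fun v => ?_⟩
    · refine (aux_cs _ v _ (hub s)).trans (mul_le_mul_of_nonneg_right (by linarith) (hnn v))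
    · refine (aux_cs _ v _ (hu'b s)).trans (mul_le_mul_of_nonneg_right (by linarith) (hnn v))
    · refine (aux_cs _ v _ (hu''b s)).trans (mul_le_mul_of_nonneg_right (by linarith) (hnn v))
    · refine (aux_cs _ v _ le_rfl).trans (mul_le_mul_of_nonneg_right (by linarith) (hnn v))
  have hB0 : 0 < B := by linarith
  have habs : ∀ (x : ℝ) (v : Fin n → ℝ), v ⬝ᵥ v ≤ 1 → x ^ 2 ≤ B * (v ⬝ᵥ v) → |x| ≤ B := by
    intro x v hv hx
    apply abs_le_of_sq_le_sq _ hB0.le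
    nlinarith
  set θ : ℝ := 1 / (100 * B) with hθ
  have hθ0 : 0 < θ := by positivity
  have hθB : B * θ = 1 / 100 := by rw [hθ]; field_simp
  obtain ⟨η₂, hη₂, H₂⟩ := aux_A (3 * B) δ (δ * (μ * θ / 2)) (by positivity) hδ (by positivity)
  obtain ⟨ε₁, hε₁, hε₁a, hε₁b, hε₁c⟩ : ∃ ε > 0, ε ≤ η₂ / 4 ∧ ε ≤ δ / 400 ∧
      ε ≤ δ * (μ * θ / 2) :=
    ⟨min (η₂ / 4) (min (δ / 400) (δ * (μ * θ / 2))), by positivity, min_le_left _ _,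
      (min_le_right _ _).trans (min_le_left _ _), (min_le_right _ _).trans (min_le_right _ _)⟩
  obtain ⟨η₁, hη₁, H₁⟩ := aux_A (3 * B) δ ε₁ (by positivity) hδ hε₁
  obtain ⟨S₀, hS0, hSa, hSb, hSc, hSd⟩ : ∃ S > 0, S ≤ η₂ / 4 ∧ S ≤ δ / 400 ∧
      S ≤ δ * (μ * θ / 2) ∧ S ≤ η₁ :=
    ⟨min (η₂ / 4) (min (δ / 400) (min (δ * (μ * θ / 2)) η₁)), by positivity, min_le_left _ _,
      (min_le_right _ _).trans (min_le_left _ _),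
      (min_le_right _ _).trans ((min_le_right _ _).trans (min_le_left _ _)),
      (min_le_right _ _).trans ((min_le_right _ _).trans (min_le_right _ _))⟩
  refine ⟨S₀ / δ, by positivity, ?_⟩
  intro t ht v₁ v₂ c₁ c₂ c₃ hsum
  by_contra hcon
  rw [ge_iff_le, not_le, one_div, inv_mul_eq_div, div_lt_div_iff_of_pos_right hδ] at hcon
  have hp0 := hnn v₁
  have hq0 := hnn v₂
  have hd1 := hnn ((D * Zᵀ) *ᵥ v₁)
  have hd2 := hnn ((D * Zᵀ) *ᵥ v₂)
  have hp1 : v₁ ⬝ᵥ v₁ ≤ 1 := by nlinarith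
  have hq1 : v₂ ⬝ᵥ v₂ ≤ 1 := by nlinarith
  have hcc2 : |c₂| ≤ 1 := by rw [← sq_le_one_iff_abs_le_one]; nlinarith
  have hcc3 : |c₃| ≤ 1 := by rw [← sq_le_one_iff_abs_le_one]; nlinarith
  have pe1 := aux_pe Z D u' hucts' δ μ t (hpe t ht) v₁
  have pe2 := aux_pe Z D u' hucts' δ μ t (hpe t ht) v₂
  set d₁ := ((D * Zᵀ) *ᵥ v₁) ⬝ᵥ ((D * Zᵀ) *ᵥ v₁)
  set d₂ := ((D * Zᵀ) *ᵥ v₂) ⬝ᵥ ((D * Zᵀ) *ᵥ v₂)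
  have hcf : Continuous fun s => u s ⬝ᵥ v₁ - σ ⬝ᵥ v₂ + c₂ := by
    have := hc0 v₁; fun_prop
  have hcg : Continuous fun s => u' s ⬝ᵥ v₁ + 2 * (u s ⬝ᵥ v₂) + c₃ := by
    have := hc1 v₁; have := hc0 v₂; fun_prop
  have hch : Continuous fun s => 2 * (u s ⬝ᵥ v₂) + c₃ := by
    have := hc0 v₂; fun_prop
  have hif := (hcf.fun_pow 2).intervalIntegrable (μ := volume) t (t + δ)
  have hig := (hcg.fun_pow 2).intervalIntegrable (μ := volume) t (t + δ)
  have hih := (hch.fun_pow 2).intervalIntegrable (μ := volume) t (t + δ)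
  have hiu1 := ((hc1 v₁).fun_pow 2).intervalIntegrable (μ := volume) t (t + δ)
  have hle : t ≤ t + δ := by linarith
  have hsplit : (∫ s in t..(t + δ), (c₁ ^ 2 + d₁ + (u s ⬝ᵥ v₁ - σ ⬝ᵥ v₂ + c₂) ^ 2 + d₂ +
      (u' s ⬝ᵥ v₁ + 2 * (u s ⬝ᵥ v₂) + c₃) ^ 2)) =
      δ * c₁ ^ 2 + δ * d₁ + (∫ s in t..(t + δ), (u s ⬝ᵥ v₁ - σ ⬝ᵥ v₂ + c₂) ^ 2) + δ * d₂ +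
      ∫ s in t..(t + δ), (u' s ⬝ᵥ v₁ + 2 * (u s ⬝ᵥ v₂) + c₃) ^ 2 := by
    have k : ∀ c : ℝ, IntervalIntegrable (fun _ : ℝ => c) volume t (t + δ) := fun c => by simp
    rw [intervalIntegral.integral_add (((k _).add hif).add (k _)) hig,
      intervalIntegral.integral_add ((k _).add hif) (k _),
      intervalIntegral.integral_add (k _) hif]
    simp only [intervalIntegral.integral_const, smul_eq_mul, add_sub_cancel_left]
    ring
  rw [hsplit] at hcon
  have hF0 : 0 ≤ ∫ s in t..(t + δ), (u s ⬝ᵥ v₁ - σ ⬝ᵥ v₂ + c₂) ^ 2 :=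
    intervalIntegral.integral_nonneg hle fun s _ => sq_nonneg _
  have hG0 : 0 ≤ ∫ s in t..(t + δ), (u' s ⬝ᵥ v₁ + 2 * (u s ⬝ᵥ v₂) + c₃) ^ 2 :=
    intervalIntegral.integral_nonneg hle fun s _ => sq_nonneg _
  have m1 : 0 ≤ δ * c₁ ^ 2 := by positivity
  have m2 : 0 ≤ δ * d₁ := by positivity
  have m3 : 0 ≤ δ * d₂ := by positivity
  set F := ∫ s in t..(t + δ), (u s ⬝ᵥ v₁ - σ ⬝ᵥ v₂ + c₂) ^ 2 with hF
  set G := ∫ s in t..(t + δ), (u' s ⬝ᵥ v₁ + 2 * (u s ⬝ᵥ v₂) + c₃) ^ 2 with hG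
  -- step 1
  have hI1 : (∫ s in t..(t + δ), (u' s ⬝ᵥ v₁) ^ 2) ≤ ε₁ := by
    apply H₁ t (fun s => u s ⬝ᵥ v₁ - σ ⬝ᵥ v₂ + c₂) (fun s => u' s ⬝ᵥ v₁) (fun s => u'' s ⬝ᵥ v₁)
    · intro s; exact ((hder v₁ s).sub_const _).add_const _
    · exact hder' v₁
    · exact hc2 v₁
    · intro s
      have a1 := abs_le.1 (habs _ v₁ hp1 (hBu s v₁))
      have a2 := abs_le.1 (habs _ v₂ hq1 (hBσ v₂))
      have a3 := abs_le.1 hcc2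
      exact abs_le.2 ⟨by linarith, by linarith⟩
    · intro s; linarith [habs _ v₁ hp1 (hBu' s v₁)]
    · intro s; linarith [habs _ v₁ hp1 (hBu'' s v₁)]
    · linarith
  have hI10 : 0 ≤ ∫ s in t..(t + δ), (u' s ⬝ᵥ v₁) ^ 2 :=
    intervalIntegral.integral_nonneg hle fun s _ => sq_nonneg _
  set I₁ := ∫ s in t..(t + δ), (u' s ⬝ᵥ v₁) ^ 2 with hI1d
  have hp : v₁ ⬝ᵥ v₁ ≤ θ := by
    have : δ * (μ * (v₁ ⬝ᵥ v₁)) ≤ δ * d₁ + I₁ := by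
      calc _ ≤ δ * (d₁ + 1 / δ * I₁) := by gcongr
        _ = _ := by field_simp
    have : (δ * μ) * (v₁ ⬝ᵥ v₁) ≤ (δ * μ) * θ := by nlinarith
    exact le_of_mul_le_mul_left this (by positivity)
  -- step 2
  have hX : (∫ s in t..(t + δ), (2 * (u s ⬝ᵥ v₂) + c₃) ^ 2) ≤ 2 * G + 2 * I₁ := by
    rw [hG, hI1d, ← intervalIntegral.integral_const_mul, ← intervalIntegral.integral_const_mul,
      ← intervalIntegral.integral_add (hig.const_mul _) (hiu1.const_mul _)]
    apply intervalIntegral.integral_mono_on hle hih ((hig.const_mul _).add (hiu1.const_mul _))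
    intro s _
    exact aux_sq1 _ _ _
  have hI2 : (∫ s in t..(t + δ), (2 * (u' s ⬝ᵥ v₂)) ^ 2) ≤ δ * (μ * θ / 2) := by
    apply H₂ t (fun s => 2 * (u s ⬝ᵥ v₂) + c₃) (fun s => 2 * (u' s ⬝ᵥ v₂))
      (fun s => 2 * (u'' s ⬝ᵥ v₂))
    · intro s; exact ((hder v₂ s).const_mul _).add_const _
    · intro s; exact (hder' v₂ s).const_mul _
    · exact continuous_const.mul (hc2 v₂)
    · intro s
      have a1 := abs_le.1 (habs _ v₂ hq1 (hBu s v₂))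
      have a3 := abs_le.1 hcc3
      exact abs_le.2 ⟨by linarith, by linarith⟩
    · intro s
      have a1 := abs_le.1 (habs _ v₂ hq1 (hBu' s v₂))
      exact abs_le.2 ⟨by linarith, by linarith⟩
    · intro s
      have a1 := abs_le.1 (habs _ v₂ hq1 (hBu'' s v₂))
      exact abs_le.2 ⟨by linarith, by linarith⟩
    · linarith
  have hI20 : 0 ≤ ∫ s in t..(t + δ), (u' s ⬝ᵥ v₂) ^ 2 :=
    intervalIntegral.integral_nonneg hle fun s _ => sq_nonneg _
  simp only [mul_pow] at hI2
  rw [intervalIntegral.integral_const_mul] at hI2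
  set I₂ := ∫ s in t..(t + δ), (u' s ⬝ᵥ v₂) ^ 2 with hI2d
  have hq : v₂ ⬝ᵥ v₂ ≤ θ := by
    have : δ * (μ * (v₂ ⬝ᵥ v₂)) ≤ δ * d₂ + I₂ := by
      calc _ ≤ δ * (d₂ + 1 / δ * I₂) := by gcongr
        _ = _ := by field_simp
    have : (δ * μ) * (v₂ ⬝ᵥ v₂) ≤ (δ * μ) * θ := by nlinarith
    exact le_of_mul_le_mul_left this (by positivity)
  have hBp : B * (v₁ ⬝ᵥ v₁) ≤ 1 / 100 := by rw [← hθB]; gcongr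
  have hBq : B * (v₂ ⬝ᵥ v₂) ≤ 1 / 100 := by rw [← hθB]; gcongr
  have hθ1 : θ ≤ 1 / 100 := by nlinarith
  -- step 3
  have hc2b : δ * (c₂ ^ 2 / 3 - 2 / 100) ≤ F := by
    have : (∫ s in t..(t + δ), (c₂ ^ 2 / 3 - 2 / 100)) ≤ F := by
      apply intervalIntegral.integral_mono_on hle (by simp) hif
      intro s _
      have a1 := hBu s v₁
      have a2 := hBσ v₂
      exact aux_sq2 _ _ _ (by linarith) (by linarith)
    simpa only [intervalIntegral.integral_const, smul_eq_mul, add_sub_cancel_left] using this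
  have hc3b : δ * (c₃ ^ 2 / 2 - 4 / 100) ≤ 2 * G + 2 * I₁ := by
    refine le_trans ?_ hX
    have : (∫ s in t..(t + δ), (c₃ ^ 2 / 2 - 4 / 100)) ≤
        ∫ s in t..(t + δ), (2 * (u s ⬝ᵥ v₂) + c₃) ^ 2 := by
      apply intervalIntegral.integral_mono_on hle (by simp) hih
      intro s _
      have a1 := hBu s v₂
      exact aux_sq3 _ _ (by linarith)
    simpa only [intervalIntegral.integral_const, smul_eq_mul, add_sub_cancel_left] using this
  have f1 : c₁ ^ 2 ≤ 1 / 400 := le_of_mul_le_mul_left (by linarith) hδ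
  have f2 : c₂ ^ 2 / 3 - 2 / 100 ≤ 1 / 400 := le_of_mul_le_mul_left (by linarith) hδ
  have f3 : c₃ ^ 2 / 2 - 4 / 100 ≤ 1 / 100 := le_of_mul_le_mul_left (by linarith) hδ
  linarith
end
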